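/- Let λ ≠ 0, assume K_{h,Q,x}(−λ) is finite, and assume h(x,·) is integrable with respect to the (h,Q,λ)-Gibbs probability measure P^{(h,Q,λ)}_{Y|X=x}. Then for every probability measure P on ℝ^m with P ≪ Q such that h(x,·) is integrable with respect to P and D(P‖Q) is finite, the variation G_h(x, P, P^{(h,Q,λ)}_{Y|X=x}) = ∫ h(x,y) dP(y) − ∫ h(x,y) dP^{(h,Q,λ)}_{Y|X=x}(y) satisfies G_h(x, P, P^{(h,Q,λ)}_{Y|X=x}) = (1/λ) ( D(P‖P^{(h,Q,λ)}_{Y|X=x}) + D(P^{(h,Q,λ)}_{Y|X=x}‖Q) − D(P‖Q) ). -/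

import Mathlib

open MeasureTheory Real ProbabilityTheory

/-- Real-valued relative entropy (KL divergence) `D(μ‖ν) = ∫ log (dμ/dν) dμ`. -/
noncomputable def klDivR {α : Type*} [MeasurableSpace α] (μ ν : Measure α) : ℝ :=
  ∫ y, Real.log ((μ.rnDeriv ν y).toReal) ∂μ

/-- `cgfK h Q x t = K_{h,Q,x}(t) = log ∫ exp (t * h x y) dQ(y)`. -/
noncomputable def cgfK {n m : ℕ} (h : (Fin n → ℝ) → (Fin m → ℝ) → ℝ)
    (Q : Measure (Fin m → ℝ)) (x : Fin n → ℝ) (t : ℝ) : ℝ :=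
  Real.log (∫ y, Real.exp (t * h x y) ∂Q)

/-- The `(h,Q,λ)`-Gibbs probability measure `P^{(h,Q,λ)}_{Y|X=x}`, which has density
`exp (-λ * h(x,y) - K_{h,Q,x}(-λ))` with respect to `Q`. -/
noncomputable def gibbs {n m : ℕ} (h : (Fin n → ℝ) → (Fin m → ℝ) → ℝ)
    (Q : Measure (Fin m → ℝ)) (lam : ℝ) (x : Fin n → ℝ) : Measure (Fin m → ℝ) :=
  Q.withDensity fun y => ENNReal.ofReal (Real.exp (-lam * h x y - cgfK h Q x (-lam)))

/-- The Gibbs measure is the exponential tilting of `Q` by `-lam * h x`. -/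
lemma gibbs_eq_tilted {n m : ℕ} (h : (Fin n → ℝ) → (Fin m → ℝ) → ℝ)
    (Q : Measure (Fin m → ℝ)) (x : Fin n → ℝ) (lam : ℝ)
    (hpos : 0 < ∫ y, Real.exp (-lam * h x y) ∂Q) :
    gibbs h Q lam x = Q.tilted fun y => -lam * h x y := by
  simp only [gibbs, Measure.tilted, cgfK, Real.exp_sub, Real.exp_log hpos]

/-- Relative entropy of an exponential tilting with respect to the base measure. -/
lemma klDivR_tilted_left_self {α : Type*} [MeasurableSpace α] {μ : Measure α} [SigmaFinite μ]
    [NeZero μ] {f : α → ℝ} (hf : Integrable (fun y => Real.exp (f y)) μ)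
    (hfint : Integrable f (μ.tilted f)) :
    klDivR (μ.tilted f) μ = ∫ y, f y ∂(μ.tilted f) - Real.log (∫ y, Real.exp (f y) ∂μ) := by
  have := isProbabilityMeasure_tilted hf
  rw [klDivR, integral_congr_ae
    ((tilted_absolutelyContinuous μ f).ae_le (log_rnDeriv_tilted_left_self hf)),
    integral_sub hfint (integrable_const _)]
  simp

theorem stmt6 {n m : ℕ} (h : (Fin n → ℝ) → (Fin m → ℝ) → ℝ)
    (hMeas : Measurable (Function.uncurry h))
    (Q : Measure (Fin m → ℝ)) [SigmaFinite Q]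
    (x : (Fin n → ℝ)) (lam : ℝ) (hlam : lam ≠ 0)
    (hKint : Integrable (fun y => Real.exp (-lam * h x y)) Q)
    (hKpos : 0 < ∫ y, Real.exp (-lam * h x y) ∂Q)
    (hGint : Integrable (h x) (gibbs h Q lam x)) :
    ∀ P : Measure (Fin m → ℝ), IsProbabilityMeasure P → P ≪ Q →
      Integrable (h x) P →
      Integrable (fun y => Real.log ((P.rnDeriv Q y).toReal)) P →
      (∫ y, h x y ∂P) - (∫ y, h x y ∂(gibbs h Q lam x))
        = (1 / lam) * (klDivR P (gibbs h Q lam x) + klDivR (gibbs h Q lam x) Q - klDivR P Q) := by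
  intro P _ hPQ hP hlog
  have : NeZero Q := ⟨by rintro rfl; simp at hKpos⟩
  rw [gibbs_eq_tilted h Q x lam hKpos] at hGint ⊢
  have hPG : klDivR P (Q.tilted fun y => -lam * h x y) = klDivR P Q
      - ∫ y, -lam * h x y ∂P + Real.log (∫ y, Real.exp (-lam * h x y) ∂Q) :=
    integral_llr_tilted_right hPQ (hP.const_mul _) hKint hlog
  rw [hPG, klDivR_tilted_left_self hKint (hGint.const_mul _), integral_const_mul,
    integral_const_mul]
  field_simp
  ring
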